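/- Let P be a finite poset and M ⊆ P an antichain (any two distinct elements of M are incomparable). If the inclusion of the subcomplex ⋃_{m∈M} (ΔP_{<m} * ΔP_{>m}) of ΔP_{∉M} into ΔP_{∉M} is null-homotopic, then ΔP ≃ ΔP_{∉M} ∨ ⋁_{m∈M} Σ(ΔP_{<m} * ΔP_{>m}). -/

import Mathlib

/-- The geometric realization of the order complex of the subposet of `P` induced on `S`:
functions `P → ℝ` that are nonnegative, finitely supported, sum to `1`, and whose support is
a chain contained in `S`. Simplices are exactly the finite chains of `S`. -/
def ocSet (P : Type) [Preorder P] (S : Set P) : Set (P → ℝ) :=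
  {f | (∀ x, 0 ≤ f x) ∧ (Function.support f).Finite ∧ (∑ᶠ x, f x) = 1 ∧
    Function.support f ⊆ S ∧ IsChain (· ≤ ·) (Function.support f)}

/-- The order complex `Δ S` of the subposet induced on `S`, as a topological space. -/
abbrev ΔSp {P : Type} [Preorder P] (S : Set P) : Type := ↥(ocSet P S)

lemma ocSet_mono {P : Type} [Preorder P] {S T : Set P} (h : S ⊆ T) :
    ocSet P S ⊆ ocSet P T :=
  fun _ hf => ⟨hf.1, hf.2.1, hf.2.2.1, hf.2.2.2.1.trans h, hf.2.2.2.2⟩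

/-- The inclusion of order complexes induced by `S ⊆ T`. -/
def ΔIncl {P : Type} [Preorder P] {S T : Set P} (h : S ⊆ T) : C(ΔSp S, ΔSp T) :=
  ⟨Set.inclusion (ocSet_mono h), continuous_inclusion (ocSet_mono h)⟩
/-- The topological join `X * Y`: the double mapping cylinder of `X ← X × I × Y → Y`
(so that `X * ∅ = X` and `∅ * Y = Y`). -/
abbrev TopJoin (X Y : Type) [TopologicalSpace X] [TopologicalSpace Y] : Type :=
  Quot (fun a b : (X ⊕ (X × unitInterval × Y)) ⊕ Y =>
    (∃ x y, a = Sum.inl (Sum.inr (x, 0, y)) ∧ b = Sum.inl (Sum.inl x)) ∨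
    (∃ x y, a = Sum.inl (Sum.inr (x, 1, y)) ∧ b = Sum.inr y))

/-- The (unreduced) suspension `Σ X = S⁰ * X`. -/
abbrev Susp (X : Type) [TopologicalSpace X] : Type := TopJoin Bool X

/-- The wedge (one-point union) of two pointed spaces. -/
abbrev Wedge (X Y : Type) [TopologicalSpace X] [TopologicalSpace Y] (x0 : X) (y0 : Y) : Type :=
  Quot (fun a b : X ⊕ Y => a = Sum.inl x0 ∧ b = Sum.inr y0)

/-- The wedge of a family of pointed spaces (with an auxiliary base point glued to all the
base points of the family, so that the empty wedge is a one-point space). -/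
abbrev BigWedge {ι : Type} (X : ι → Type) [∀ i, TopologicalSpace (X i)] (pt : ∀ i, X i) : Type :=
  Quot (fun a b : (Σ i, X i) ⊕ Unit => (∃ i, a = Sum.inl ⟨i, pt i⟩) ∧ b = Sum.inr ())

/-- The base point of a wedge of a family. -/
def BigWedge.base {ι : Type} {X : ι → Type} [∀ i, TopologicalSpace (X i)] {pt : ∀ i, X i} :
    BigWedge X pt :=
  Quot.mk _ (Sum.inr ())


open unitInterval Topology

section Gluing

variable {X A L Z : Type} [TopologicalSpace X] [TopologicalSpace A] [TopologicalSpace L]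
  [TopologicalSpace Z]

/-- The double mapping cylinder of `X ← L → A`. -/
abbrev DoubleMappingCylinder (f : C(L, X)) (p : C(L, A)) : Type :=
  Quot (fun a b : (X ⊕ (L × I)) ⊕ A =>
    (∃ l, a = Sum.inl (Sum.inr (l, 0)) ∧ b = Sum.inl (Sum.inl (f l))) ∨
    (∃ l, a = Sum.inl (Sum.inr (l, 1)) ∧ b = Sum.inr (p l)))

namespace DoubleMappingCylinder

variable {f g : C(L, X)} {p : C(L, A)}

/-- The inclusion of the left end. -/
def inl (x : X) : DoubleMappingCylinder f p := Quot.mk _ (Sum.inl (Sum.inl x))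

/-- The inclusion of the right end. -/
def inr (a : A) : DoubleMappingCylinder f p := Quot.mk _ (Sum.inr a)

/-- The point at height `t` over `l`. -/
def cyl (l : L) (t : I) : DoubleMappingCylinder f p := Quot.mk _ (Sum.inl (Sum.inr (l, t)))

lemma cyl_zero (l : L) : (cyl l 0 : DoubleMappingCylinder f p) = inl (f l) :=
  Quot.sound (Or.inl ⟨l, rfl, rfl⟩)

lemma cyl_one (l : L) : (cyl l 1 : DoubleMappingCylinder f p) = inr (p l) :=
  Quot.sound (Or.inr ⟨l, rfl, rfl⟩)

lemma continuous_inl : Continuous (inl : X → DoubleMappingCylinder f p) :=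
  continuous_quot_mk.comp (by fun_prop)

lemma continuous_inr : Continuous (inr : A → DoubleMappingCylinder f p) :=
  continuous_quot_mk.comp (by fun_prop)

lemma continuous_cyl :
    Continuous (fun q : L × I => (cyl q.1 q.2 : DoubleMappingCylinder f p)) :=
  continuous_quot_mk.comp (by fun_prop)

lemma ind {C : DoubleMappingCylinder f p → Prop} (h₁ : ∀ x, C (inl x))
    (h₂ : ∀ l t, C (cyl l t)) (h₃ : ∀ a, C (inr a)) (z) : C z := by
  induction z using Quot.ind with
  | mk z =>
    rcases z with (x | ⟨l, t⟩) | a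
    exacts [h₁ x, h₂ l t, h₃ a]

lemma ind_of_ne {C : DoubleMappingCylinder f p → Prop} (h₁ : ∀ x, C (inl x))
    (h₂ : ∀ l t, t ≠ 0 → t ≠ 1 → C (cyl l t)) (h₃ : ∀ a, C (inr a)) (z) : C z := by
  induction z using ind with
  | h₁ x => exact h₁ x
  | h₂ l t =>
    by_cases h0 : t = 0
    · rw [h0, cyl_zero]
      exact h₁ (f l)
    by_cases h1 : t = 1
    · rw [h1, cyl_one]
      exact h₃ (p l)
    exact h₂ l t h0 h1
  | h₃ a => exact h₃ a

/-- The map out of a double mapping cylinder given by compatible maps on its three parts. -/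
def lift (a : X → Z) (b : L → I → Z) (c : A → Z) (h₀ : ∀ l, b l 0 = a (f l))
    (h₁ : ∀ l, b l 1 = c (p l)) : DoubleMappingCylinder f p → Z :=
  Quot.lift (Sum.elim (Sum.elim a (fun q => b q.1 q.2)) c) (by
    rintro _ _ (⟨l, rfl, rfl⟩ | ⟨l, rfl, rfl⟩)
    exacts [h₀ l, h₁ l])

lemma continuous_lift {a : X → Z} {b : L → I → Z} {c : A → Z} {h₀ : ∀ l, b l 0 = a (f l)}
    {h₁ : ∀ l, b l 1 = c (p l)} (ha : Continuous a) (hb : Continuous fun q : L × I => b q.1 q.2)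
    (hc : Continuous c) : Continuous (lift a b c h₀ h₁) :=
  continuous_quot_lift _ ((ha.sumElim hb).sumElim hc)

/-- A family of self-maps fixing both ends, given over each point of the middle by a path from
`0` to `1`, is a homotopy. -/
lemma homotopic_id {φ : C(DoubleMappingCylinder f p, DoubleMappingCylinder f p)}
    (E : I → L → I → DoubleMappingCylinder f p)
    (hE : Continuous fun q : I × (L × I) => E q.1 q.2.1 q.2.2)
    (hl : ∀ x, φ (inl x) = inl x) (hr : ∀ a, φ (inr a) = inr a)
    (hE₀ : ∀ l t, E 0 l t = φ (cyl l t)) (hE₁ : ∀ l t, E 1 l t = cyl l t)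
    (h₀ : ∀ s l, E s l 0 = inl (f l)) (h₁ : ∀ s l, E s l 1 = inr (p l)) :
    φ.Homotopic (ContinuousMap.id _) := by
  refine ⟨⟨⟨fun q => lift inl (E q.1) inr (h₀ q.1) (h₁ q.1) q.2, ?_⟩, ?_, ?_⟩⟩
  · refine isQuotientMap_quot_mk.continuous_lift_prod_right ?_
    let e : I × ((X ⊕ (L × I)) ⊕ A) ≃ₜ ((I × X) ⊕ (I × (L × I))) ⊕ (I × A) :=
      Homeomorph.prodSumDistrib.trans (Homeomorph.prodSumDistrib.sumCongr (.refl _))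
    refine e.symm.isQuotientMap.continuous_iff.2
      (continuous_sum_dom.2 ⟨continuous_sum_dom.2 ⟨?_, ?_⟩, ?_⟩)
    exacts [continuous_inl.comp continuous_snd, hE, continuous_inr.comp continuous_snd]
  · refine fun z => ?_
    induction z using ind with
    | h₁ x => exact (hl x).symm
    | h₂ l t => exact hE₀ l t
    | h₃ a => exact (hr a).symm
  · refine fun z => ?_
    induction z using ind with
    | h₁ x => rfl
    | h₂ l t => exact hE₁ l t
    | h₃ a => rfl

/-- The extension of the cylinder over `l` by the path `H (·, l)`, parametrized by `ℝ`. -/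
noncomputable def extend (p : C(L, A)) (H : f.Homotopy g) (l : L) (u : ℝ) :
    DoubleMappingCylinder g p :=
  if 0 ≤ u then cyl l (Set.projIcc 0 1 zero_le_one u)
  else inl (H (Set.projIcc 0 1 zero_le_one (1 + u), l))

lemma continuous_extend (H : f.Homotopy g) :
    Continuous fun q : L × ℝ => extend p H q.1 q.2 := by
  refine Continuous.if_le (continuous_cyl.comp (f := fun q : L × ℝ =>
      (q.1, Set.projIcc 0 1 zero_le_one q.2)) ?_) (continuous_inl.comp ?_) continuous_const
    continuous_snd ?_
  · exact continuous_fst.prodMk (continuous_projIcc.comp continuous_snd)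
  · exact H.continuous.comp ((continuous_projIcc.comp (by fun_prop)).prodMk continuous_fst)
  · rintro ⟨l, u⟩ (rfl : 0 = u)
    simp [cyl_zero]

lemma extend_of_mem (H : f.Homotopy g) (l : L) (t : I) : extend p H l t = cyl l t := by
  rw [extend, if_pos t.2.1, Set.projIcc_val]

lemma extend_zero (H : f.Homotopy g) (l : L) : extend p H l 0 = inl (g l) := by
  simpa [cyl_zero] using extend_of_mem (p := p) H l 0

lemma extend_one (H : f.Homotopy g) (l : L) : extend p H l 1 = inr (p l) := by
  simpa [cyl_one] using extend_of_mem (p := p) H l 1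

lemma extend_neg_one (H : f.Homotopy g) (l : L) : extend p H l (-1) = inl (f l) := by
  rw [extend, if_neg (by norm_num)]
  simp

/-- The map of double mapping cylinders induced by a homotopy of the left map. -/
noncomputable def ofHomotopy (p : C(L, A)) (H : f.Homotopy g) :
    C(DoubleMappingCylinder f p, DoubleMappingCylinder g p) where
  toFun := lift inl (fun l t => extend p H l (2 * t - 1)) inr
    (fun l => by simpa using extend_neg_one H l)
    (fun l => by
      have : (2 * ((1 : I) : ℝ) - 1) = 1 := by norm_num
      simpa only [this] using extend_one H l)
  continuous_toFun := continuous_lift continuous_inl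
    ((continuous_extend H).comp (f := fun q : L × I => (q.1, 2 * (q.2 : ℝ) - 1)) (by fun_prop))
    continuous_inr

lemma ofHomotopy_comp_cyl (H : f.Homotopy g) (l : L) (t : I) :
    ofHomotopy p H.symm (ofHomotopy p H (cyl l t)) =
      extend p H.symm l (max (-2 * t) (4 * t - 3)) := by
  change ofHomotopy p H.symm (extend p H l (2 * t - 1)) = _
  have h0 := t.2.1
  have h1 := t.2.2
  by_cases h : 0 ≤ 2 * (t : ℝ) - 1
  · rw [extend, if_pos h]
    change extend p H.symm l (2 * _ - 1) = _
    rw [Set.coe_projIcc, min_eq_right (by linarith), max_eq_right h, max_eq_right (by linarith)]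
    congr 1
    ring
  · rw [extend, if_neg h, max_eq_left (by linarith)]
    change inl _ = _
    rcases h0.eq_or_lt with h0 | h0
    · rw [← h0]
      simp [extend_zero]
    · rw [extend, if_neg (by linarith), ContinuousMap.Homotopy.symm_apply]
      congr 3
      ext
      rw [Set.coe_projIcc, unitInterval.coe_symm_eq, Set.coe_projIcc,
        min_eq_right (by linarith), max_eq_right (by linarith),
        min_eq_right (by linarith), max_eq_right (by linarith)]
      ring

lemma ofHomotopy_comp_homotopic (H : f.Homotopy g) :
    ((ofHomotopy p H.symm).comp (ofHomotopy p H)).Homotopic (ContinuousMap.id _) := by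
  refine homotopic_id
    (fun s l t => extend p H.symm l ((1 - (s : ℝ)) * max (-2 * (t : ℝ)) (4 * t - 3) + s * t))
    ((continuous_extend H.symm).comp (f := fun q : I × (L × I) => (q.2.1,
      (1 - (q.1 : ℝ)) * max (-2 * (q.2.2 : ℝ)) (4 * q.2.2 - 3) + q.1 * q.2.2)) (by fun_prop))
    (fun x => rfl) (fun a => rfl) (fun l t => ?_) (fun l t => ?_) (fun s l => ?_) (fun s l => ?_)
  · rw [ContinuousMap.comp_apply, ofHomotopy_comp_cyl]
    simp
  · simpa using extend_of_mem H.symm l t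
  · simpa using extend_zero H.symm l
  · convert extend_one (p := p) H.symm l using 2
    norm_num

/-- Homotopic left maps have homotopy equivalent double mapping cylinders. -/
noncomputable def homotopyEquivOfHomotopy (p : C(L, A)) (H : f.Homotopy g) :
    ContinuousMap.HomotopyEquiv (DoubleMappingCylinder f p) (DoubleMappingCylinder g p) where
  toFun := ofHomotopy p H
  invFun := ofHomotopy p H.symm
  left_inv := ofHomotopy_comp_homotopic H
  right_inv := by simpa using ofHomotopy_comp_homotopic (p := p) H.symm

end DoubleMappingCylinder

end Gluing

namespace TopJoin

variable {X Y : Type} [TopologicalSpace X] [TopologicalSpace Y]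

/-- The inclusion of the first space. -/
def inl (x : X) : TopJoin X Y := Quot.mk _ (Sum.inl (Sum.inl x))

/-- The inclusion of the second space. -/
def inr (y : Y) : TopJoin X Y := Quot.mk _ (Sum.inr y)

/-- The point with parameter `t` on the segment from `x` to `y`. -/
def seg (x : X) (t : I) (y : Y) : TopJoin X Y := Quot.mk _ (Sum.inl (Sum.inr (x, t, y)))

lemma seg_zero (x : X) (y : Y) : seg x 0 y = inl x := Quot.sound (Or.inl ⟨x, y, rfl, rfl⟩)

lemma seg_one (x : X) (y : Y) : seg x 1 y = inr y := Quot.sound (Or.inr ⟨x, y, rfl, rfl⟩)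

lemma continuous_seg : Continuous fun q : X × I × Y => seg q.1 q.2.1 q.2.2 :=
  continuous_quot_mk.comp (by fun_prop)

lemma ind {C : TopJoin X Y → Prop} (h₁ : ∀ x, C (inl x))
    (h₂ : ∀ x t y, t ≠ 0 → t ≠ 1 → C (seg x t y)) (h₃ : ∀ y, C (inr y)) (z) : C z := by
  induction z using Quot.ind with
  | mk z =>
    rcases z with (x | ⟨x, t, y⟩) | y
    · exact h₁ x
    · by_cases h0 : t = 0
      · have := h₁ x
        rw [← seg_zero x y] at this
        rwa [h0]
      by_cases h1 : t = 1
      · have := h₃ y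
        rw [← seg_one x y] at this
        rwa [h1]
      exact h₂ x t y h0 h1
    · exact h₃ y

end TopJoin

section Suspension

variable {X ι : Type} [TopologicalSpace X] {J : ι → Type} [∀ i, TopologicalSpace (J i)]

lemma continuous_sigma_prod {Z : Type} [TopologicalSpace Z] {f : (Σ i, J i) × I → Z}
    (h : ∀ i, Continuous fun q : J i × I => f (⟨i, q.1⟩, q.2)) : Continuous f :=
  (Homeomorph.sigmaProdDistrib (X := J) (Y := I)).symm.isQuotientMap.continuous_iff.2
    (continuous_sigma h)

/-- The wedge of `X` and of the suspensions of the `J i`, each based at its `false` pole. -/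
abbrev SuspWedge (J : ι → Type) [∀ i, TopologicalSpace (J i)] (x₀ : X) : Type :=
  Wedge X (BigWedge (fun i => Susp (J i)) (fun _ => TopJoin.inl false)) x₀ BigWedge.base

namespace SuspWedge

variable {x₀ : X}

/-- The inclusion of `X` into the wedge. -/
def inl (x : X) : SuspWedge J x₀ := Quot.mk _ (Sum.inl x)

/-- The inclusion of a suspension into the wedge. -/
def inSusp (i : ι) (y : Susp (J i)) : SuspWedge J x₀ :=
  Quot.mk _ (Sum.inr (Quot.mk _ (Sum.inl ⟨i, y⟩)))

lemma continuous_inl : Continuous (inl : X → SuspWedge J x₀) :=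
  continuous_quot_mk.comp (by fun_prop)

lemma continuous_inSusp (i : ι) : Continuous (inSusp i : Susp (J i) → SuspWedge J x₀) :=
  continuous_quot_mk.comp (continuous_inr.comp (continuous_quot_mk.comp
    (_root_.continuous_inl.comp continuous_sigmaMk)))

lemma base_eq : (Quot.mk _ (Sum.inr BigWedge.base) : SuspWedge J x₀) = inl x₀ :=
  (Quot.sound ⟨rfl, rfl⟩).symm

lemma inSusp_pole_false (i : ι) :
    (inSusp i (TopJoin.inl false) : SuspWedge J x₀) = inl x₀ := by
  rw [← base_eq]
  exact congrArg (fun z => Quot.mk _ (Sum.inr z)) (Quot.sound ⟨⟨i, rfl⟩, rfl⟩)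

lemma ind {C : SuspWedge J x₀ → Prop} (h₁ : ∀ x, C (inl x))
    (h₂ : ∀ i b, C (inSusp i (TopJoin.inl b))) (h₃ : ∀ i b t y, C (inSusp i (TopJoin.seg b t y))) (z) :
    C z := by
  induction z using Quot.ind with
  | mk z =>
    rcases z with x | z
    · exact h₁ x
    · induction z using Quot.ind with
      | mk z =>
        rcases z with ⟨i, z⟩ | u
        · induction z using TopJoin.ind with
          | h₁ b => exact h₂ i b
          | h₂ b t y => exact h₃ i b t y
          | h₃ y => exact TopJoin.seg_one true y ▸ h₃ i true 1 y
        · exact (base_eq (J := J) (x₀ := x₀)).symm ▸ h₁ x₀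

variable [TopologicalSpace ι]

/-- The projection of a disjoint union to its index set. -/
def sigmaFst (J : ι → Type) [∀ i, TopologicalSpace (J i)] : C(Σ i, J i, ι) where
  toFun := Sigma.fst
  continuous_toFun := continuous_sigma fun _ => continuous_const

/-- The double mapping cylinder of `X ← Σ i, J i → ι` whose left map is constant. -/
abbrev ConstCylinder (J : ι → Type) [∀ i, TopologicalSpace (J i)] (x₀ : X) : Type :=
  DoubleMappingCylinder (ContinuousMap.const (Σ i, J i) x₀) (sigmaFst J)

/-- The point of the suspension at height `u` over `y`, running from one pole to the other. -/
noncomputable def height {Y : Type} [TopologicalSpace Y] (y : Y) (u : I) : Susp Y :=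
  if (u : ℝ) ≤ 1 / 2 then TopJoin.seg false (Set.projIcc 0 1 zero_le_one (2 * (u : ℝ))) y
  else TopJoin.seg true (Set.projIcc 0 1 zero_le_one (2 - 2 * (u : ℝ))) y

lemma continuous_height {Y : Type} [TopologicalSpace Y] :
    Continuous fun q : Y × I => height q.1 q.2 := by
  refine Continuous.if_le
    (TopJoin.continuous_seg.comp (f := fun q : Y × I =>
      (false, Set.projIcc 0 1 zero_le_one (2 * (q.2 : ℝ)), q.1))
      (continuous_const.prodMk ((continuous_projIcc.comp (by fun_prop)).prodMk continuous_fst)))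
    (TopJoin.continuous_seg.comp (f := fun q : Y × I =>
      (true, Set.projIcc 0 1 zero_le_one (2 - 2 * (q.2 : ℝ)), q.1))
      (continuous_const.prodMk ((continuous_projIcc.comp (by fun_prop)).prodMk continuous_fst)))
    (by fun_prop) (by fun_prop) ?_
  rintro ⟨y, u⟩ (h : (u : ℝ) = 1 / 2)
  norm_num [h, TopJoin.seg_one]

lemma height_zero {Y : Type} [TopologicalSpace Y] (y : Y) : height y 0 = TopJoin.inl false := by
  simp [height, TopJoin.seg_zero]

lemma height_one {Y : Type} [TopologicalSpace Y] (y : Y) : height y 1 = TopJoin.inl true := by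
  norm_num [height, TopJoin.seg_zero]

/-- The height corresponding to the coordinate `t` on the side `b` of a suspension. -/
noncomputable def level (b : Bool) (t : I) : I :=
  Set.projIcc 0 1 zero_le_one (if b then 1 - (t : ℝ) / 2 else t / 2)

lemma coe_level (b : Bool) (t : I) :
    (level b t : ℝ) = if b then 1 - (t : ℝ) / 2 else t / 2 := by
  have h0 := t.2.1
  have h1 := t.2.2
  rw [level, Set.coe_projIcc]
  split_ifs <;> rw [min_eq_right (by linarith), max_eq_right (by linarith)]

lemma continuous_level (b : Bool) : Continuous (level b) := by
  cases b <;> refine continuous_projIcc.comp ?_ <;>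
    simp only [if_true, Bool.false_eq_true, if_false] <;> fun_prop

lemma height_level {Y : Type} [TopologicalSpace Y] (b : Bool) (t : I) (y : Y) :
    height y (level b t) = TopJoin.seg b t y := by
  have h1 := t.2.2
  have hp : ∀ u : ℝ, u = t → Set.projIcc 0 1 zero_le_one u = t := by
    rintro _ rfl
    exact Set.projIcc_val _ t
  cases b
  · have : (level false t : ℝ) = t / 2 := by simp [coe_level]
    rw [height, this, if_pos (by linarith), hp _ (by ring)]
  · have : (level true t : ℝ) = 1 - t / 2 := by simp [coe_level]
    rw [height, this]
    split_ifs with h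
    · have ht : t = 1 := Subtype.ext (by simp only [Set.Icc.coe_one]; linarith)
      subst ht
      norm_num [TopJoin.seg_one]
    · rw [hp _ (by ring)]

/-- The map from the cylinder to the wedge. -/
noncomputable def ofCylinder : ConstCylinder J x₀ → SuspWedge J x₀ :=
  DoubleMappingCylinder.lift inl (fun l u => inSusp l.1 (height l.2 u))
    (fun i => inSusp i (TopJoin.inl true))
    (fun l => by rw [height_zero, inSusp_pole_false]; rfl)
    (fun l => by rw [height_one]; rfl)

lemma continuous_ofCylinder [DiscreteTopology ι] :
    Continuous (ofCylinder : ConstCylinder J x₀ → SuspWedge J x₀) :=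
  DoubleMappingCylinder.continuous_lift continuous_inl
    (continuous_sigma_prod fun i => (continuous_inSusp i).comp continuous_height)
    continuous_of_discreteTopology

/-- The map from a suspension to the cylinder. -/
noncomputable def suspToCylinder (x₀ : X) (i : ι) : Susp (J i) → ConstCylinder J x₀ :=
  Quot.lift (Sum.elim (Sum.elim
      (fun b => if b then DoubleMappingCylinder.inr i else DoubleMappingCylinder.inl x₀)
      (fun q => DoubleMappingCylinder.cyl ⟨i, q.2.2⟩ (level q.1 q.2.1)))
      (fun y => DoubleMappingCylinder.cyl ⟨i, y⟩ (level false 1))) (by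
    rintro _ _ (⟨b, y, rfl, rfl⟩ | ⟨b, y, rfl, rfl⟩)
    · cases b
      · have : level false 0 = 0 := Subtype.ext (by simp [coe_level])
        exact (congrArg _ this).trans (DoubleMappingCylinder.cyl_zero _)
      · have : level true 0 = 1 := Subtype.ext (by simp [coe_level])
        exact (congrArg _ this).trans (DoubleMappingCylinder.cyl_one _)
    · have : level b 1 = level false 1 := Subtype.ext (by cases b <;> norm_num [coe_level])
      exact congrArg (DoubleMappingCylinder.cyl _) this)

lemma continuous_suspToCylinder (i : ι) :
    Continuous (suspToCylinder x₀ i : Susp (J i) → ConstCylinder J x₀) := by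
  refine continuous_quot_lift _ ((continuous_of_discreteTopology.sumElim ?_).sumElim ?_)
  · refine DoubleMappingCylinder.continuous_cyl.comp (f := fun q : Bool × I × J i =>
      ((⟨i, q.2.2⟩ : Σ i, J i), level q.1 q.2.1)) (Continuous.prodMk ?_ ?_)
    · exact continuous_sigmaMk.comp (by fun_prop)
    · exact continuous_prod_of_discrete_left.2 fun b =>
        (continuous_level b).comp continuous_fst
  · exact DoubleMappingCylinder.continuous_cyl.comp (f := fun y : J i =>
      ((⟨i, y⟩ : Σ i, J i), level false 1)) (continuous_sigmaMk.prodMk continuous_const)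

/-- The map from the wedge to the cylinder. -/
noncomputable def toCylinder : SuspWedge J x₀ → ConstCylinder J x₀ :=
  Quot.lift (Sum.elim DoubleMappingCylinder.inl
    (Quot.lift (Sum.elim (fun z => suspToCylinder x₀ z.1 z.2)
      (fun _ => DoubleMappingCylinder.inl x₀)) (by rintro _ _ ⟨⟨i, rfl⟩, rfl⟩; rfl)))
    (by rintro _ _ ⟨rfl, rfl⟩; rfl)

lemma continuous_toCylinder : Continuous (toCylinder : SuspWedge J x₀ → ConstCylinder J x₀) :=
  continuous_quot_lift _ (DoubleMappingCylinder.continuous_inl.sumElim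
    (continuous_quot_lift _ ((continuous_sigma continuous_suspToCylinder).sumElim
      continuous_const)))

/-- Coning off disjoint spaces along a constant map yields the wedge with their suspensions. -/
noncomputable def homeomorph [DiscreteTopology ι] (J : ι → Type) [∀ i, TopologicalSpace (J i)]
    (x₀ : X) :
    ConstCylinder J x₀ ≃ₜ SuspWedge J x₀ where
  toFun := ofCylinder
  invFun := toCylinder
  left_inv z := by
    induction z using DoubleMappingCylinder.ind with
    | h₁ x => rfl
    | h₂ l u =>
      change suspToCylinder x₀ l.1 (height l.2 u) = _
      have h0 := u.2.1
      have h1 := u.2.2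
      rw [height]
      split_ifs with h
      · change DoubleMappingCylinder.cyl l (level _ _) = _
        congr 1
        ext
        rw [coe_level, Set.coe_projIcc, min_eq_right (by linarith), max_eq_right (by linarith)]
        simp
      · change DoubleMappingCylinder.cyl l (level _ _) = _
        congr 1
        ext
        rw [coe_level, Set.coe_projIcc, min_eq_right (by linarith), max_eq_right (by linarith)]
        simp only [if_true]
        ring
    | h₃ i => rfl
  right_inv z := by
    induction z using ind with
    | h₁ x => rfl
    | h₂ i b =>
      cases b
      · exact (inSusp_pole_false i).symm
      · rfl
    | h₃ i b t y => exact congrArg (inSusp i) (height_level b t y)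
  continuous_toFun := continuous_ofCylinder
  continuous_invFun := continuous_toCylinder

end SuspWedge

end Suspension

section OrderComplex

variable {P : Type}

/-- The convex combination of `a` and `b` with weight `t` on `b`. -/
def mix (t : I) (a b : P → ℝ) : P → ℝ := (1 - (t : ℝ)) • a + (t : ℝ) • b

lemma mix_apply (t : I) (a b : P → ℝ) (x : P) : mix t a b x = (1 - t) * a x + t * b x := rfl

lemma mix_zero (a b : P → ℝ) : mix 0 a b = a := by simp [mix]

lemma mix_one (a b : P → ℝ) : mix 1 a b = b := by simp [mix]

lemma continuous_mix : Continuous fun q : I × (P → ℝ) × (P → ℝ) => mix q.1 q.2.1 q.2.2 := by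
  unfold mix
  fun_prop

variable [PartialOrder P]

lemma Iio_comparable_Ioi (m : P) : ∀ x ∈ Set.Iio m, ∀ y ∈ Set.Ioi m, x ≤ y ∨ y ≤ x :=
  fun _ hx _ hy => Or.inl (le_of_lt (lt_trans hx hy))

lemma link_comparable (m : P) : ∀ x ∈ Set.Iio m ∪ Set.Ioi m, ∀ y ∈ ({m} : Set P),
    x ≤ y ∨ y ≤ x := by
  rintro x (hx | hx) _ rfl
  exacts [Or.inl (le_of_lt hx), Or.inr (le_of_lt hx)]

variable [Fintype P] {S T : Set P}

lemma mem_ocSet_iff {f : P → ℝ} : f ∈ ocSet P S ↔ (∀ x, 0 ≤ f x) ∧ ∑ x, f x = 1 ∧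
    (∀ x ∉ S, f x = 0) ∧ ∀ x y, f x ≠ 0 → f y ≠ 0 → x ≤ y ∨ y ≤ x := by
  rw [ocSet, Set.mem_ofPred_eq, finsum_eq_sum_of_fintype, Function.support_subset_iff']
  refine and_congr_right fun _ => ?_
  rw [and_iff_right (Set.toFinite _)]
  refine and_congr_right fun _ => and_congr_right fun _ => ⟨fun h x y hx hy => h.total hx hy,
    fun h x hx y hy _ => h x y hx hy⟩

lemma isCompact_ocSet (S : Set P) : IsCompact (ocSet P S) := by
  refine (isCompact_Icc (a := (0 : P → ℝ)) (b := 1)).of_isClosed_subset ?_ ?_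
  · have : ocSet P S = {f | (∀ x, 0 ≤ f x) ∧ ∑ x, f x = 1 ∧ (∀ x ∉ S, f x = 0) ∧
        ∀ x y, ¬ (x ≤ y ∨ y ≤ x) → f x * f y = 0} := by
      ext f
      rw [mem_ocSet_iff]
      refine and_congr_right fun _ => and_congr_right fun _ => and_congr_right fun _ =>
        forall₂_congr fun x y => ?_
      rw [mul_eq_zero]
      tauto
    rw [this]
    simp only [Set.ofPred_and, Set.ofPred_forall]
    refine IsClosed.inter (isClosed_iInter fun x => ?_) (IsClosed.inter ?_ (IsClosed.inter
      (isClosed_iInter fun x => isClosed_iInter fun _ => ?_)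
      (isClosed_iInter fun x => isClosed_iInter fun y => isClosed_iInter fun _ => ?_)))
    · exact isClosed_le (by fun_prop) (by fun_prop)
    · exact isClosed_eq (by fun_prop) (by fun_prop)
    · exact isClosed_eq (by fun_prop) (by fun_prop)
    · exact isClosed_eq (by fun_prop) (by fun_prop)
  · intro f hf
    obtain ⟨h0, h1, -⟩ := mem_ocSet_iff.1 hf
    exact ⟨h0, fun x =>
      (Finset.single_le_sum (fun y _ => h0 y) (Finset.mem_univ x)).trans_eq h1⟩

instance (S : Set P) : CompactSpace (ΔSp S) := isCompact_iff_compactSpace.1 (isCompact_ocSet S)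

lemma mix_mem (hST : ∀ x ∈ S, ∀ y ∈ T, x ≤ y ∨ y ≤ x) (t : I) {a b : P → ℝ}
    (ha : a ∈ ocSet P S) (hb : b ∈ ocSet P T) : mix t a b ∈ ocSet P (S ∪ T) := by
  obtain ⟨a0, a1, aS, aC⟩ := mem_ocSet_iff.1 ha
  obtain ⟨b0, b1, bT, bC⟩ := mem_ocSet_iff.1 hb
  have aS' : ∀ x, a x ≠ 0 → x ∈ S := fun x => not_imp_comm.1 (aS x)
  have bT' : ∀ x, b x ≠ 0 → x ∈ T := fun x => not_imp_comm.1 (bT x)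
  have key : ∀ x, mix t a b x ≠ 0 → a x ≠ 0 ∨ b x ≠ 0 := by
    intro x hx
    by_contra! h
    exact hx (by simp [mix_apply, h.1, h.2])
  have t0 := t.2.1
  have t1 := t.2.2
  refine mem_ocSet_iff.2 ⟨fun x => ?_, ?_, fun x hx => ?_, fun x y hx hy => ?_⟩
  · exact add_nonneg (mul_nonneg (by linarith) (a0 x)) (mul_nonneg t0 (b0 x))
  · simp only [mix_apply, Finset.sum_add_distrib, ← Finset.mul_sum, a1, b1]
    ring
  · rw [Set.mem_union, not_or] at hx
    simp [mix_apply, aS x hx.1, bT x hx.2]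
  · rcases key x hx with hx | hx <;> rcases key y hy with hy | hy
    · exact aC x y hx hy
    · exact hST x (aS' x hx) y (bT' y hy)
    · exact (hST y (aS' y hy) x (bT' x hx)).symm
    · exact bC x y hx hy

/-- The total mass of `f` on `T`. -/
noncomputable def weight (T : Set P) (f : P → ℝ) : ℝ := ∑ x, T.indicator f x

lemma weight_of_mem {f : P → ℝ} (hf : f ∈ ocSet P T) : weight T f = 1 := by
  obtain ⟨-, h1, hT, -⟩ := mem_ocSet_iff.1 hf
  rw [weight, Set.indicator_eq_self.2 (Function.support_subset_iff'.2 hT), h1]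

lemma weight_of_disjoint (hST : Disjoint S T) {f : P → ℝ} (hf : f ∈ ocSet P S) :
    weight T f = 0 := by
  obtain ⟨-, -, hS, -⟩ := mem_ocSet_iff.1 hf
  refine Finset.sum_eq_zero fun x _ => Set.indicator_apply_eq_zero.2 fun hx => ?_
  exact hS x (hST.notMem_of_mem_right hx)

lemma weight_mix (hST : Disjoint S T) (t : I) {a b : P → ℝ} (ha : a ∈ ocSet P S)
    (hb : b ∈ ocSet P T) : weight T (mix t a b) = t := by
  have : weight T (mix t a b) = (1 - t) * weight T a + t * weight T b := by
    simp only [weight, Finset.mul_sum, ← Finset.sum_add_distrib]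
    refine Finset.sum_congr rfl fun x _ => ?_
    by_cases hx : x ∈ T <;> simp [hx, mix_apply]
  rw [this, weight_of_mem hb, weight_of_disjoint hST ha]
  ring

lemma mix_injective (hST : Disjoint S T) {t t' : I} (h0 : t ≠ 0) (h1 : t ≠ 1)
    {a b a' b' : P → ℝ} (ha : a ∈ ocSet P S) (hb : b ∈ ocSet P T) (ha' : a' ∈ ocSet P S)
    (hb' : b' ∈ ocSet P T) (h : mix t a b = mix t' a' b') : t = t' ∧ a = a' ∧ b = b' := by
  obtain rfl : t = t' := Subtype.ext <| by
    rw [← weight_mix hST t ha hb, h, weight_mix hST t' ha' hb']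
  have aS := (mem_ocSet_iff.1 ha).2.2.1
  have aS' := (mem_ocSet_iff.1 ha').2.2.1
  have bT := (mem_ocSet_iff.1 hb).2.2.1
  have bT' := (mem_ocSet_iff.1 hb').2.2.1
  have h0 : (t : ℝ) ≠ 0 := fun e => h0 (Subtype.ext e)
  have h1 : 1 - (t : ℝ) ≠ 0 := fun e => h1 (Subtype.ext (sub_eq_zero.1 e).symm)
  have hx : ∀ x, (1 - (t : ℝ)) * a x + t * b x = (1 - t) * a' x + t * b' x := congrFun h
  have key : ∀ x, a x = a' x ∧ b x = b' x := by
    intro x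
    specialize hx x
    by_cases hxS : x ∈ S
    · have hxT := hST.notMem_of_mem_left hxS
      rw [bT x hxT, bT' x hxT] at hx ⊢
      exact ⟨mul_left_cancel₀ h1 (add_right_cancel hx), rfl⟩
    · rw [aS x hxS, aS' x hxS] at hx ⊢
      exact ⟨rfl, mul_left_cancel₀ h0 (add_left_cancel hx)⟩
  exact ⟨rfl, funext fun x => (key x).1, funext fun x => (key x).2⟩

lemma smul_indicator_mem {f : P → ℝ} (hf : f ∈ ocSet P (S ∪ T)) (h : weight S f ≠ 0) :
    (weight S f)⁻¹ • S.indicator f ∈ ocSet P S := by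
  obtain ⟨f0, -, -, fC⟩ := mem_ocSet_iff.1 hf
  have hi : ∀ x, 0 ≤ S.indicator f x := fun x => Set.indicator_nonneg (fun x _ => f0 x) x
  have hw : 0 ≤ weight S f := Finset.sum_nonneg fun x _ => hi x
  have key : ∀ x, ((weight S f)⁻¹ • S.indicator f) x ≠ 0 → f x ≠ 0 := by
    intro x hx h
    exact hx (by by_cases hS : x ∈ S <;> simp [hS, h])
  refine mem_ocSet_iff.2 ⟨fun x => mul_nonneg (inv_nonneg.2 hw) (hi x), ?_, fun x hx => ?_,
    fun x y hx hy => fC x y (key x hx) (key y hy)⟩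
  · simp only [Pi.smul_apply, smul_eq_mul, ← Finset.mul_sum]
    exact inv_mul_cancel₀ h
  · simp [hx]

lemma mem_of_weight_eq_zero {f : P → ℝ} (hf : f ∈ ocSet P (S ∪ T)) (h : weight T f = 0) :
    f ∈ ocSet P S := by
  obtain ⟨f0, f1, fS, fC⟩ := mem_ocSet_iff.1 hf
  refine mem_ocSet_iff.2 ⟨f0, f1, fun x hx => ?_, fC⟩
  by_cases hT : x ∈ T
  · have := (Finset.sum_eq_zero_iff_of_nonneg
      (fun x _ => Set.indicator_nonneg (fun x _ => f0 x) x)).1 h x (Finset.mem_univ x)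
    rwa [Set.indicator_of_mem hT] at this
  · exact fS x (by simp [hx, hT])

lemma indicator_add_indicator (hST : Disjoint S T) {f : P → ℝ} (hf : f ∈ ocSet P (S ∪ T))
    (x : P) : S.indicator f x + T.indicator f x = f x := by
  have := (mem_ocSet_iff.1 hf).2.2.1
  rw [← congrFun (Set.indicator_union_of_disjoint hST f) x,
    Set.indicator_eq_self.2 (Function.support_subset_iff'.2 this)]

lemma exists_mix (hST : Disjoint S T) {f : P → ℝ} (hf : f ∈ ocSet P (S ∪ T)) :
    f ∈ ocSet P S ∨ f ∈ ocSet P T ∨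
      ∃ t : I, t ≠ 0 ∧ t ≠ 1 ∧ ∃ a ∈ ocSet P S, ∃ b ∈ ocSet P T, f = mix t a b := by
  obtain ⟨f0, f1, -⟩ := mem_ocSet_iff.1 hf
  have hf' : f ∈ ocSet P (T ∪ S) := by rwa [Set.union_comm]
  have hS : 0 ≤ weight S f := Finset.sum_nonneg fun x _ =>
    Set.indicator_nonneg (fun x _ => f0 x) x
  have hT : 0 ≤ weight T f := Finset.sum_nonneg fun x _ =>
    Set.indicator_nonneg (fun x _ => f0 x) x
  have hsum : weight S f + weight T f = 1 := by
    rw [weight, weight, ← Finset.sum_add_distrib, ← f1]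
    exact Finset.sum_congr rfl fun x _ => indicator_add_indicator hST hf x
  by_cases hS0 : weight S f = 0
  · exact Or.inr (Or.inl (mem_of_weight_eq_zero hf' hS0))
  by_cases hT0 : weight T f = 0
  · exact Or.inl (mem_of_weight_eq_zero hf hT0)
  refine Or.inr (Or.inr ⟨⟨weight T f, hT, by linarith⟩, fun e => hT0 (congrArg Subtype.val e),
    fun e => hS0 ?_, _, smul_indicator_mem hf hS0, _, smul_indicator_mem hf' hT0, ?_⟩)
  · have : weight T f = 1 := congrArg Subtype.val e
    linarith
  · have h1 : 1 - weight T f = weight S f := by linarith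
    ext x
    rw [mix_apply]
    simp only [h1, Pi.smul_apply, smul_eq_mul, mul_inv_cancel_left₀ hS0, mul_inv_cancel_left₀ hT0]
    exact (indicator_add_indicator hST hf x).symm

/-- The map from the join of two order complexes to the order complex of the union. -/
def joinMap (hST : ∀ x ∈ S, ∀ y ∈ T, x ≤ y ∨ y ≤ x) :
    C(TopJoin (ΔSp S) (ΔSp T), ΔSp (S ∪ T)) where
  toFun := Quot.lift (Sum.elim (Sum.elim (ΔIncl Set.subset_union_left)
      (fun q => ⟨mix q.2.1 q.1 q.2.2, mix_mem hST _ q.1.2 q.2.2.2⟩))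
      (ΔIncl Set.subset_union_right)) (by
    rintro _ _ (⟨x, y, rfl, rfl⟩ | ⟨x, y, rfl, rfl⟩)
    · exact Subtype.ext (mix_zero _ _)
    · exact Subtype.ext (mix_one _ _))
  continuous_toFun := continuous_quot_lift _ (((map_continuous _).sumElim
    ((continuous_mix.comp (f := fun q : ΔSp S × I × ΔSp T =>
      (q.2.1, (q.1 : P → ℝ), (q.2.2 : P → ℝ))) (by fun_prop)).subtype_mk _)).sumElim
    (map_continuous _))

lemma joinMap_bijective (hST : ∀ x ∈ S, ∀ y ∈ T, x ≤ y ∨ y ≤ x) (hd : Disjoint S T) :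
    Function.Bijective (joinMap hST) := by
  have w₁ : ∀ x, weight T (joinMap hST (TopJoin.inl x)).1 = 0 := fun x =>
    weight_of_disjoint hd x.2
  have w₂ : ∀ x t y, weight T (joinMap hST (TopJoin.seg x t y)).1 = t :=
    fun x t y => weight_mix hd t x.2 y.2
  have w₃ : ∀ y, weight T (joinMap hST (TopJoin.inr y)).1 = 1 := fun y => weight_of_mem y.2
  have ne₀ : ∀ {t : I}, t ≠ 0 → (t : ℝ) ≠ 0 := fun h e => h (Subtype.ext e)
  have ne₁ : ∀ {t : I}, t ≠ 1 → (t : ℝ) ≠ 1 := fun h e => h (Subtype.ext e)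
  refine ⟨fun z z' h => ?_, fun f => ?_⟩
  · have hw := congrArg (fun f : ΔSp (S ∪ T) => weight T f.1) h
    have hv := congrArg Subtype.val h
    induction z using TopJoin.ind with
    | h₁ x =>
      induction z' using TopJoin.ind with
      | h₁ x' => exact congrArg TopJoin.inl (Subtype.ext hv)
      | h₂ x' t' y' h0' h1' => exact absurd (by simpa only [w₁, w₂] using hw.symm) (ne₀ h0')
      | h₃ y' => simp only [w₁, w₃, zero_ne_one] at hw
    | h₂ x t y h0 h1 =>
      induction z' using TopJoin.ind with
      | h₁ x' => exact absurd (by simpa only [w₁, w₂] using hw) (ne₀ h0)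
      | h₂ x' t' y' h0' h1' =>
        obtain ⟨rfl, hx, hy⟩ := mix_injective hd h0 h1 x.2 y.2 x'.2 y'.2 hv
        rw [Subtype.ext hx, Subtype.ext hy]
      | h₃ y' => exact absurd (by simpa only [w₂, w₃] using hw) (ne₁ h1)
    | h₃ y =>
      induction z' using TopJoin.ind with
      | h₁ x' => simp only [w₁, w₃, one_ne_zero] at hw
      | h₂ x' t' y' h0' h1' => exact absurd (by simpa only [w₂, w₃] using hw.symm) (ne₁ h1')
      | h₃ y' => exact congrArg TopJoin.inr (Subtype.ext hv)
  · rcases exists_mix hd f.2 with hf | hf | ⟨t, -, -, a, ha, b, hb, hf⟩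
    · exact ⟨TopJoin.inl ⟨f, hf⟩, rfl⟩
    · exact ⟨TopJoin.inr ⟨f, hf⟩, rfl⟩
    · exact ⟨TopJoin.seg ⟨a, ha⟩ t ⟨b, hb⟩, Subtype.ext hf.symm⟩

lemma single_mem [DecidableEq P] {m : P} (hm : m ∈ S) : Pi.single m (1 : ℝ) ∈ ocSet P S := by
  have key : ∀ x, Pi.single (M := fun _ => ℝ) m 1 x ≠ 0 → x = m := fun x hx => by
    by_contra h
    exact hx (by simp [h])
  refine mem_ocSet_iff.2 ⟨fun x => ?_, by simp, fun x hx => ?_, fun x y hx hy => ?_⟩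
  · exact (Pi.single_nonneg (α := fun _ : P => ℝ)).2 zero_le_one x
  · exact not_imp_comm.1 (key x) fun h => hx (h ▸ hm)
  · rw [key x hx, key y hy]
    exact Or.inl le_rfl

lemma eq_single_of_antichain [DecidableEq P] {M : Set P} (hM : IsAntichain (· ≤ ·) M)
    {b : P → ℝ} (hb : b ∈ ocSet P M) : ∃ m ∈ M, b = Pi.single m 1 := by
  obtain ⟨-, b1, bM, bC⟩ := mem_ocSet_iff.1 hb
  have bM' : ∀ x, b x ≠ 0 → x ∈ M := fun x => not_imp_comm.1 (bM x)
  obtain ⟨m, -, hm⟩ := Finset.exists_ne_zero_of_sum_ne_zero (b1.trans_ne one_ne_zero)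
  have hx : ∀ x, x ≠ m → b x = 0 := by
    intro x hxm
    by_contra hx
    rcases bC x m hx hm with h | h
    · exact hxm (hM.eq (bM' x hx) (bM' m hm) h)
    · exact hxm (hM.eq (bM' m hm) (bM' x hx) h).symm
  rw [Finset.sum_eq_single m (fun x _ h => hx x h) (by simp)] at b1
  refine ⟨m, bM' m hm, funext fun x => ?_⟩
  by_cases h : x = m
  · rw [h, b1, Pi.single_eq_same]
  · rw [hx x h, Pi.single_eq_of_ne h]

section Cone

variable {M : Set P}

/-- The join of the order complexes of the elements below and above `m`. -/
abbrev Link (m : P) : Type := TopJoin (ΔSp (Set.Iio m)) (ΔSp (Set.Ioi m))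

/-- The identification of the join over `m` with a subcomplex of the order complex. -/
def linkMap (m : P) : C(Link m, ΔSp (Set.Iio m ∪ Set.Ioi m)) := joinMap (Iio_comparable_Ioi m)

lemma linkMap_bijective (m : P) : Function.Bijective (linkMap m) :=
  joinMap_bijective _ (Set.disjoint_left.2 fun _ h h' => lt_asymm h h')

/-- The disjoint union of the links of the elements of `M`, mapped to the union of the links. -/
def sigmaLinkMap (M : Set P) :
    C(Σ m : M, Link (m : P), ↥(⋃ m ∈ M, ocSet P (Set.Iio m ∪ Set.Ioi m))) where
  toFun l := ⟨linkMap (l.1 : P) l.2, Set.mem_biUnion l.1.2 (linkMap (l.1 : P) l.2).2⟩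
  continuous_toFun := continuous_sigma fun m =>
    (continuous_subtype_val.comp (linkMap (m : P)).continuous).subtype_mk _

variable [TopologicalSpace M]

/-- The double mapping cylinder that attaches to `Δ Mᶜ` a cone over the link of each `m ∈ M`. -/
abbrev LinkCylinder (hsub : (⋃ m ∈ M, ocSet P (Set.Iio m ∪ Set.Ioi m)) ⊆ ocSet P Mᶜ) : Type :=
  DoubleMappingCylinder
    ((⟨Set.inclusion hsub, continuous_inclusion hsub⟩ : C(_, ΔSp Mᶜ)).comp (sigmaLinkMap M))
    (SuspWedge.sigmaFst fun m : M => Link (m : P))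

variable [DecidableEq P] (hsub : (⋃ m ∈ M, ocSet P (Set.Iio m ∪ Set.Ioi m)) ⊆ ocSet P Mᶜ)

/-- The map from the cylinder to the order complex of the whole poset. -/
noncomputable def coneMap : LinkCylinder hsub → ΔSp (Set.univ : Set P) :=
  DoubleMappingCylinder.lift (ΔIncl (Set.subset_univ _))
    (fun l t => ⟨mix t (linkMap (l.1 : P) l.2).1 (Pi.single (l.1 : P) 1),
      ocSet_mono (Set.subset_univ _) (mix_mem (link_comparable (l.1 : P)) t
        (linkMap (l.1 : P) l.2).2 (single_mem rfl))⟩)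
    (fun m => ⟨Pi.single (m : P) 1, single_mem (Set.mem_univ _)⟩)
    (fun _ => Subtype.ext (mix_zero _ _))
    (fun _ => Subtype.ext (mix_one _ _))

lemma continuous_coneMap [DiscreteTopology M] : Continuous (coneMap hsub) := by
  refine DoubleMappingCylinder.continuous_lift (map_continuous _)
    (continuous_sigma_prod fun m => Continuous.subtype_mk ?_ _) continuous_of_discreteTopology
  exact continuous_mix.comp (f := fun q : Link (m : P) × I =>
    (q.2, (linkMap (m : P) q.1).1, Pi.single (m : P) (1 : ℝ))) (by fun_prop)

lemma coneMap_bijective (hM : IsAntichain (· ≤ ·) M) : Function.Bijective (coneMap hsub) := by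
  have hd : Disjoint Mᶜ M := disjoint_compl_left
  have hl : ∀ l : Σ m : M, Link (m : P), (linkMap (l.1 : P) l.2).1 ∈ ocSet P Mᶜ :=
    fun l => hsub (sigmaLinkMap M l).2
  have hs : ∀ m : M, Pi.single (m : P) (1 : ℝ) ∈ ocSet P M := fun m => single_mem m.2
  have single_inj : ∀ {m m' : M}, Pi.single (M := fun _ => ℝ) (m : P) 1 = Pi.single (m' : P) 1 →
      m = m' := fun {m m'} h => by
    by_contra hne
    have := congrFun h m
    rw [Pi.single_eq_same, Pi.single_eq_of_ne (fun e => hne (Subtype.ext e))] at this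
    exact one_ne_zero this
  have w₁ : ∀ x, weight M (coneMap hsub (.inl x)).1 = 0 := fun x => weight_of_disjoint hd x.2
  have w₂ : ∀ l t, weight M (coneMap hsub (.cyl l t)).1 = t :=
    fun l t => weight_mix hd t (hl l) (hs l.1)
  have w₃ : ∀ m, weight M (coneMap hsub (.inr m)).1 = 1 := fun m => weight_of_mem (hs m)
  have ne₀ : ∀ {t : I}, t ≠ 0 → (t : ℝ) ≠ 0 := fun h e => h (Subtype.ext e)
  have ne₁ : ∀ {t : I}, t ≠ 1 → (t : ℝ) ≠ 1 := fun h e => h (Subtype.ext e)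
  refine ⟨fun z z' h => ?_, fun g => ?_⟩
  · have hw := congrArg (fun f : ΔSp (Set.univ : Set P) => weight M f.1) h
    have hv := congrArg Subtype.val h
    induction z using DoubleMappingCylinder.ind_of_ne with
    | h₁ x =>
      induction z' using DoubleMappingCylinder.ind_of_ne with
      | h₁ x' => exact congrArg DoubleMappingCylinder.inl (Subtype.ext hv)
      | h₂ l' t' h0' h1' => exact absurd (by simpa only [w₁, w₂] using hw.symm) (ne₀ h0')
      | h₃ m' => simp only [w₁, w₃, zero_ne_one] at hw
    | h₂ l t h0 h1 =>
      induction z' using DoubleMappingCylinder.ind_of_ne with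
      | h₁ x' => exact absurd (by simpa only [w₁, w₂] using hw) (ne₀ h0)
      | h₂ l' t' h0' h1' =>
        obtain ⟨rfl, hx, hy⟩ := mix_injective hd h0 h1 (hl l) (hs l.1) (hl l') (hs l'.1) hv
        obtain ⟨m, j⟩ := l
        obtain ⟨m', j'⟩ := l'
        obtain rfl : m = m' := single_inj hy
        obtain rfl : j = j' := (linkMap_bijective (m : P)).1 (Subtype.ext hx)
        rfl
      | h₃ m' => exact absurd (by simpa only [w₂, w₃] using hw) (ne₁ h1)
    | h₃ m =>
      induction z' using DoubleMappingCylinder.ind_of_ne with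
      | h₁ x' => simp only [w₁, w₃, one_ne_zero] at hw
      | h₂ l' t' h0' h1' => exact absurd (by simpa only [w₂, w₃] using hw.symm) (ne₁ h1')
      | h₃ m' => exact congrArg DoubleMappingCylinder.inr (single_inj hv)
  · have hg : (g : P → ℝ) ∈ ocSet P (Mᶜ ∪ M) := by
      rw [Set.compl_union_self]
      exact g.2
    rcases exists_mix hd hg with hf | hf | ⟨t, h0, h1, a, ha, b, hb, hf⟩
    · exact ⟨.inl ⟨g, hf⟩, rfl⟩
    · obtain ⟨m, hm, h⟩ := eq_single_of_antichain hM hf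
      exact ⟨.inr ⟨m, hm⟩, Subtype.ext h.symm⟩
    · obtain ⟨m, hm, rfl⟩ := eq_single_of_antichain hM hb
      obtain ⟨a0, a1, aM, aC⟩ := mem_ocSet_iff.1 ha
      have t0 : (t : ℝ) ≠ 0 := ne₀ h0
      have t1 : 1 - (t : ℝ) ≠ 0 := sub_ne_zero.2 (ne₁ h1).symm
      have gm : g.1 m ≠ 0 := by
        rw [hf, mix_apply, aM m (by simpa using hm)]
        simpa using t0
      have a_mem : a ∈ ocSet P (Set.Iio m ∪ Set.Ioi m) := by
        refine mem_ocSet_iff.2 ⟨a0, a1, fun x hx => ?_, aC⟩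
        by_contra hax
        have hxM : x ∉ M := fun h => hax (aM x (by simpa using h))
        have hxm : x ≠ m := fun h => hxM (h ▸ hm)
        have gx : g.1 x ≠ 0 := by
          rw [hf, mix_apply, Pi.single_eq_of_ne hxm]
          simpa using ⟨t1, hax⟩
        rcases (mem_ocSet_iff.1 g.2).2.2.2 x m gx gm with h | h
        · exact hx (Or.inl (lt_of_le_of_ne h hxm))
        · exact hx (Or.inr (lt_of_le_of_ne h hxm.symm))
      obtain ⟨j, hj⟩ := (linkMap_bijective m).2 ⟨a, a_mem⟩
      refine ⟨.cyl ⟨⟨m, hm⟩, j⟩ t, Subtype.ext ?_⟩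
      change mix t (linkMap m j).1 _ = _
      rw [hj, hf]

/-- The order complex is obtained from `Δ Mᶜ` by attaching a cone over each link. -/
noncomputable def coneHomeomorph [DiscreteTopology M] (hM : IsAntichain (· ≤ ·) M) :
    LinkCylinder hsub ≃ₜ ΔSp (Set.univ : Set P) :=
  (continuous_coneMap hsub).homeoOfEquivCompactToT2
    (f := Equiv.ofBijective _ (coneMap_bijective hsub hM))

end Cone

end OrderComplex

/-- **Theorem `vee_sigma`.** Let `P` be a finite poset and `M ⊆ P` an antichain.
If the inclusion of the subcomplex `⋃_{m ∈ M} (ΔP_{<m} * ΔP_{>m})` of `ΔP_{∉M}` into `ΔP_{∉M}`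
is null-homotopic, then `ΔP ≃ ΔP_{∉M} ∨ ⋁_{m ∈ M} Σ(ΔP_{<m} * ΔP_{>m})`. -/
theorem orderComplex_homotopyEquiv_wedge_of_antichain
    (P : Type) [PartialOrder P] [Finite P] (M : Set P)
    (hM : IsAntichain (· ≤ ·) M)
    (hsub : (⋃ m ∈ M, ocSet P (Set.Iio m ∪ Set.Ioi m)) ⊆ ocSet P Mᶜ)
    (hnull : ContinuousMap.Nullhomotopic
      (⟨Set.inclusion hsub, continuous_inclusion hsub⟩ :
        C(↥(⋃ m ∈ M, ocSet P (Set.Iio m ∪ Set.Ioi m)), ΔSp (Mᶜ : Set P)))) :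
    ∃ (x0 : ΔSp (Mᶜ : Set P))
      (pt : ∀ m : M, Susp (TopJoin (ΔSp (Set.Iio (m : P))) (ΔSp (Set.Ioi (m : P))))),
      Nonempty (ContinuousMap.HomotopyEquiv (ΔSp (Set.univ : Set P))
        (Wedge (ΔSp (Mᶜ : Set P))
          (BigWedge (fun m : M => Susp (TopJoin (ΔSp (Set.Iio (m : P))) (ΔSp (Set.Ioi (m : P)))))
            pt)
          x0 BigWedge.base)) := by
  classical
  cases nonempty_fintype P
  let _ : TopologicalSpace M := ⊥
  have : DiscreteTopology M := ⟨rfl⟩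
  obtain ⟨x₀, ⟨H⟩⟩ := hnull.comp_left (sigmaLinkMap M)
  exact ⟨x₀, fun _ => TopJoin.inl false,
    ⟨((coneHomeomorph hsub hM).symm.toHomotopyEquiv.trans
      (DoubleMappingCylinder.homotopyEquivOfHomotopy _ H)).trans
      (SuspWedge.homeomorph (fun m : M => Link (m : P)) x₀).toHomotopyEquiv⟩⟩
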